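/- Let λ be an uncountable cardinal. If there exists a first countable Hausdorff topological space with λ points which is (<λ)-*CWN but not λ-*CWN, then there exists a first countable Hausdorff topological space which is (<λ)-metrizable (hence (<λ)-CWH) but not λ-CWH. -/

import Mathlib

open Cardinal Topology

def SeparatedFamily {X : Type*} [TopologicalSpace X] (Y : Set X) : Prop :=
  ∃ u : Y → Set X, (∀ y, IsOpen (u y)) ∧ (∀ y, (y : X) ∈ u y) ∧
    ∀ y z : Y, y ≠ z → Disjoint (u y) (u z)

def IsCWH (X : Type*) [TopologicalSpace X] : Prop :=
  ∀ Y : Set X, DiscreteTopology Y → SeparatedFamily Y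

/-- `X` is collectionwise normal (in the sense used here): every ordinal-indexed sequence of
pairwise disjoint subsets, each clopen in the subspace given by their union, can be separated
by pairwise disjoint open sets. -/
def IsCWN (X : Type) [TopologicalSpace X] : Prop :=
  ∀ (a : Ordinal.{0}) (Y : Ordinal.{0} → Set X),
    (∀ i < a, ∀ j < a, i ≠ j → Disjoint (Y i) (Y j)) →
    (∀ i < a, IsClopen (Subtype.val ⁻¹' (Y i) : Set (⋃ j ∈ Set.Iio a, Y j))) →
    ∃ U : Ordinal → Set X, (∀ i < a, IsOpen (U i)) ∧ (∀ i < a, Y i ⊆ U i) ∧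
      ∀ i < a, ∀ j < a, i ≠ j → Disjoint (U i) (U j)

/-- A first countable Hausdorff space with `lam` points which is `(<lam)`-*CWN but
not `lam`-*CWN. -/
def Stmt17Hyp (lam : Cardinal) (X : Type) [TopologicalSpace X] : Prop :=
  FirstCountableTopology X ∧ T2Space X ∧ #X = lam ∧
  (∀ Y : Set X, #Y < lam → IsCWN Y) ∧
  ¬∀ Y : Set X, #Y ≤ lam → IsCWN Y

/-- A first countable Hausdorff space which is `(<lam)`-metrizable (hence `(<lam)`-CWH)
but not `lam`-CWH. -/
def Stmt17Concl (lam : Cardinal) (X : Type) [TopologicalSpace X] : Prop :=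
  FirstCountableTopology X ∧ T2Space X ∧
  (∀ Y : Set X, #Y < lam → TopologicalSpace.MetrizableSpace Y) ∧
  (∀ Y : Set X, #Y < lam → IsCWH Y) ∧
  ¬∀ Y : Set X, #Y ≤ lam → IsCWH Y

/-- Being `IsCWN` is invariant under homeomorphisms. -/
theorem IsCWN.of_homeomorph {A B : Type} [TopologicalSpace A] [TopologicalSpace B]
    (e : A ≃ₜ B) (h : IsCWN B) : IsCWN A := by
  intro a Y hdis hclopen
  have hmem : ∀ x : (⋃ j ∈ Set.Iio a, e.symm ⁻¹' Y j : Set B),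
      e.symm x.1 ∈ ⋃ j ∈ Set.Iio a, Y j := by
    intro x
    have := x.2
    simpa using this
  have hcont : Continuous fun x => (⟨e.symm x.1, hmem x⟩ : (⋃ j ∈ Set.Iio a, Y j : Set A)) := by
    fun_prop
  obtain ⟨U, hU, hsub, hd⟩ := h a (fun i => e.symm ⁻¹' Y i)
    (fun i hi j hj hij => (hdis i hi j hj hij).preimage _)
    (fun i hi => (hclopen i hi).preimage hcont)
  refine ⟨fun i => e ⁻¹' U i, fun i hi => (hU i hi).preimage e.continuous, fun i hi x hx => ?_,
    fun i hi j hj hij => (hd i hi j hj hij).preimage _⟩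
  exact hsub i hi (by simpa using hx)

/-- Metrizable spaces are collectionwise Hausdorff. -/
theorem IsCWH.of_metrizableSpace (X : Type*) [TopologicalSpace X]
    [TopologicalSpace.MetrizableSpace X] : IsCWH X := by
  intro Y hY
  let _ := TopologicalSpace.metrizableSpaceMetric X
  have hr : ∀ y : Y, ∃ r > 0, ∀ z : Y, dist (z : X) y < r → z = y := by
    intro y
    obtain ⟨r, hr, h⟩ := Metric.isOpen_iff.1 (isOpen_discrete ({y} : Set Y)) y rfl
    exact ⟨r, hr, fun z hz => h hz⟩
  choose r hr h using hr
  refine ⟨fun y => Metric.ball y (r y / 2), fun y => Metric.isOpen_ball,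
    fun y => Metric.mem_ball_self (half_pos (hr y)), fun y z hyz => ?_⟩
  rw [Set.disjoint_left]
  intro x hxy hxz
  rw [Metric.mem_ball] at hxy hxz
  have hd := dist_triangle_left (y : X) z x
  rcases le_total (r y) (r z) with hle | hle
  · exact hyz (h z y (by linarith))
  · exact hyz (h y z (by rw [dist_comm]; linarith)).symm

/-- A `T₀` space is metrizable if its topology is induced by countably many locally constant
maps. -/
theorem metrizableSpace_of_isLocallyConstant {T D : Type*} [TopologicalSpace T] [T0Space T]
    (g : ℕ → T → D) (hg : ∀ k, IsLocallyConstant (g k))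
    (h : ∀ x, ∀ U ∈ 𝓝 x, ∃ k, ∀ y, g k y = g k x → y ∈ U) :
    TopologicalSpace.MetrizableSpace T := by
  let _ : TopologicalSpace D := ⊥
  have _ : DiscreteTopology D := ⟨rfl⟩
  have hcont : Continuous fun (x : T) (k : ℕ) => g k x :=
    continuous_pi fun k => (hg k).continuous
  have hind : IsInducing fun (x : T) (k : ℕ) => g k x := by
    refine isInducing_iff_nhds.2 fun x => le_antisymm (hcont.tendsto x).le_comap fun U hU => ?_
    obtain ⟨k, hk⟩ := h x U hU
    refine ⟨{z | z k = g k x}, ?_, fun y hy => hk y hy⟩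
    have hopen : IsOpen ((fun z : ℕ → D => z k) ⁻¹' {g k x}) :=
      (isOpen_discrete {g k x}).preimage (continuous_apply k)
    exact hopen.mem_nhds rfl
  let _ : UniformSpace D := ⊥
  have := hind.pseudoMetrizableSpace
  infer_instance

/-- A `T₁` first countable space is metrizable if its non-isolated points can be separated by
pairwise disjoint basic neighbourhoods. -/
theorem metrizableSpace_of_pairwiseDisjoint {T : Type*} [TopologicalSpace T] [T1Space T]
    (v : T → ℕ → Set T) (hv : ∀ x, (𝓝 x).HasAntitoneBasis (v x)) (C : Set T)
    (hC : ∀ x ∉ C, 𝓝 x = pure x) (f : T → ℕ) (hdis : C.PairwiseDisjoint fun y => v y (f y)) :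
    TopologicalSpace.MetrizableSpace T := by
  classical
  have huniq : ∀ k x y z, y ∈ C → z ∈ C → x ∈ v y (max k (f y)) → x ∈ v z (f z) → y = z := by
    intro k x y z hy hz hxy hxz
    by_contra hne
    exact Set.disjoint_left.1 (hdis hy hz hne) ((hv y).antitone (le_max_right _ _) hxy) hxz
  let g : ℕ → T → T := fun k x =>
    if h : ∃ y ∈ C, x ∈ v y (max k (f y)) then h.choose else x
  have hg_mem : ∀ k, ∀ y ∈ C, ∀ x ∈ v y (max k (f y)), g k x = y := by
    intro k y hy x hx
    have h : ∃ y ∈ C, x ∈ v y (max k (f y)) := ⟨y, hy, hx⟩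
    simp only [g, dif_pos h]
    exact huniq k x _ y h.choose_spec.1 hy h.choose_spec.2
      ((hv y).antitone (le_max_right _ _) hx)
  have hg_cases : ∀ k x, g k x = x ∨ g k x ∈ C ∧ x ∈ v (g k x) (max k (f (g k x))) := by
    intro k x
    by_cases h : ∃ y ∈ C, x ∈ v y (max k (f y))
    · right
      simp only [g, dif_pos h]
      exact h.choose_spec
    · left
      simp only [g, dif_neg h]
  refine metrizableSpace_of_isLocallyConstant g (fun k => ?_) fun x U hU => ?_
  · refine (IsLocallyConstant.iff_eventually_eq _).2 fun x => ?_
    by_cases hx : x ∈ C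
    · filter_upwards [(hv x).mem (max k (f x))] with z hz
      rw [hg_mem k x hx z hz, hg_mem k x hx x (mem_of_mem_nhds ((hv x).mem _))]
    · rw [hC x hx]
      exact Filter.eventually_pure.2 rfl
  · by_cases hx : x ∈ C
    · obtain ⟨k, hk⟩ := (hv x).mem_iff.1 hU
      refine ⟨k, fun z hz => ?_⟩
      rw [hg_mem k x hx x (mem_of_mem_nhds ((hv x).mem _))] at hz
      rcases hg_cases k z with h | h
      · rw [← h, hz]
        exact mem_of_mem_nhds hU
      · rw [hz] at h
        exact hk ((hv x).antitone (le_max_left _ _) h.2)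
    · have hfar : ∃ k, g k x = x := by
        by_cases h : ∃ y ∈ C, x ∈ v y (f y)
        · obtain ⟨y, hy, hxy⟩ := h
          have hne : y ≠ x := fun h => hx (h ▸ hy)
          obtain ⟨k, hk⟩ := (hv y).mem_iff.1 (isOpen_compl_singleton.mem_nhds hne)
          refine ⟨k, (hg_cases k x).resolve_right fun h => ?_⟩
          have := huniq k x _ y h.1 hy h.2 hxy
          rw [this] at h
          exact hk ((hv y).antitone (le_max_left _ _) h.2) rfl
        · refine ⟨0, (hg_cases 0 x).resolve_right fun h' => h ?_⟩
          exact ⟨_, h'.1, (hv _).antitone (le_max_right _ _) h'.2⟩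
      obtain ⟨k, hk⟩ := hfar
      refine ⟨k, fun z hz => ?_⟩
      rw [hk] at hz
      rcases hg_cases k z with h | h
      · rw [← h, hz]
        exact mem_of_mem_nhds hU
      · exact absurd (hz ▸ h.1) hx

/-- The disjoint union of a set `P` of centres and a set `Q` of isolated points, in which the
centre `p` has the sets `{p} ∪ N p k` as a neighbourhood basis. -/
def FanSpace {P Q : Type*} (_N : P → ℕ → Set Q) : Type _ := P ⊕ Q

namespace FanSpace

variable {P Q : Type*} {N : P → ℕ → Set Q}

/-- The centres of a fan space. -/
def center (N : P → ℕ → Set Q) (p : P) : FanSpace N := Sum.inl p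

/-- The isolated points of a fan space. -/
def leaf (N : P → ℕ → Set Q) (q : Q) : FanSpace N := Sum.inr q

theorem center_injective : Function.Injective (center N) := Sum.inl_injective

theorem leaf_injective : Function.Injective (leaf N) := Sum.inr_injective

theorem center_ne_leaf (p : P) (q : Q) : center N p ≠ leaf N q := Sum.inl_ne_inr

instance : TopologicalSpace (FanSpace N) where
  IsOpen U := ∀ p, center N p ∈ U → ∃ k, ∀ j ≥ k, ∀ q ∈ N p j, leaf N q ∈ U
  isOpen_univ := fun _ _ => ⟨0, fun _ _ _ _ => trivial⟩
  isOpen_inter := fun U V hU hV p hp => by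
    obtain ⟨k, hk⟩ := hU p hp.1
    obtain ⟨l, hl⟩ := hV p hp.2
    exact ⟨max k l, fun j hj q hq => ⟨hk j (le_of_max_le_left hj) q hq,
      hl j (le_of_max_le_right hj) q hq⟩⟩
  isOpen_sUnion := fun S hS p ⟨U, hU, hp⟩ => by
    obtain ⟨k, hk⟩ := hS U hU p hp
    exact ⟨k, fun j hj q hq => ⟨U, hU, hk j hj q hq⟩⟩

theorem isOpen_iff {U : Set (FanSpace N)} :
    IsOpen U ↔ ∀ p, center N p ∈ U → ∃ k, ∀ j ≥ k, ∀ q ∈ N p j, leaf N q ∈ U := Iff.rfl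

/-- The basic neighbourhoods in a fan space. -/
def basicNhd (N : P → ℕ → Set Q) : FanSpace N → ℕ → Set (FanSpace N)
  | Sum.inl p, k => insert (center N p) (leaf N '' N p k)
  | Sum.inr q, _ => {leaf N q}

theorem basicNhd_center (p : P) (k : ℕ) :
    basicNhd N (center N p) k = insert (center N p) (leaf N '' N p k) := rfl

theorem leaf_mem_basicNhd_center {p : P} {k : ℕ} {q : Q} :
    leaf N q ∈ basicNhd N (center N p) k ↔ q ∈ N p k := by
  simp [basicNhd_center, (center_ne_leaf p q).symm, leaf_injective.eq_iff]

theorem center_mem_basicNhd_center {p p' : P} {k : ℕ} :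
    center N p' ∈ basicNhd N (center N p) k ↔ p' = p := by
  simp [basicNhd_center, center_injective.eq_iff, (center_ne_leaf _ _).symm]

theorem isOpen_singleton_leaf (q : Q) : IsOpen {leaf N q} :=
  isOpen_iff.2 fun p hp => absurd hp (center_ne_leaf p q)

theorem isOpen_basicNhd (hN : ∀ p, Antitone (N p)) (x : FanSpace N) (k : ℕ) :
    IsOpen (basicNhd N x k) := by
  rcases x with p | q
  · refine isOpen_iff.2 fun p' hp' => ⟨k, fun j hj q hq => ?_⟩
    obtain rfl := center_mem_basicNhd_center.1 hp'
    exact leaf_mem_basicNhd_center.2 (hN _ hj hq)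
  · exact isOpen_singleton_leaf q

theorem mem_basicNhd_self (x : FanSpace N) (k : ℕ) : x ∈ basicNhd N x k := by
  rcases x with p | q
  · exact center_mem_basicNhd_center.2 rfl
  · rfl

theorem hasAntitoneBasis_nhds (hN : ∀ p, Antitone (N p)) (x : FanSpace N) :
    (𝓝 x).HasAntitoneBasis (basicNhd N x) := by
  refine ⟨⟨fun U => ⟨fun hU => ?_, fun ⟨k, _, hk⟩ => Filter.mem_of_superset
    ((isOpen_basicNhd hN x k).mem_nhds (mem_basicNhd_self x k)) hk⟩⟩, fun k l hkl => ?_⟩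
  · obtain ⟨V, hVU, hV, hx⟩ := mem_nhds_iff.1 hU
    rcases x with p | q
    · obtain ⟨k, hk⟩ := isOpen_iff.1 hV p hx
      refine ⟨k, trivial, Set.insert_subset (hVU hx) ?_⟩
      rintro _ ⟨q, hq, rfl⟩
      exact hVU (hk k le_rfl q hq)
    · exact ⟨0, trivial, Set.singleton_subset_iff.2 (hVU hx)⟩
  · rcases x with p | q
    · exact Set.insert_subset_insert (Set.image_mono (hN p hkl))
    · exact le_rfl

theorem firstCountableTopology (hN : ∀ p, Antitone (N p)) :
    FirstCountableTopology (FanSpace N) :=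
  ⟨fun x => (hasAntitoneBasis_nhds hN x).1.isCountablyGenerated⟩

theorem disjoint_basicNhd_center {p p' : P} (hne : p ≠ p') {k l : ℕ}
    (h : Disjoint (N p k) (N p' l)) :
    Disjoint (basicNhd N (center N p) k) (basicNhd N (center N p') l) := by
  rw [Set.disjoint_left] at h ⊢
  rintro (r | q) hx hx'
  · exact hne ((center_mem_basicNhd_center.1 hx).symm.trans (center_mem_basicNhd_center.1 hx'))
  · exact h (leaf_mem_basicNhd_center.1 hx) (leaf_mem_basicNhd_center.1 hx')

theorem t2Space (hN : ∀ p, Antitone (N p)) (hinter : ∀ p q, ∃ k, q ∉ N p k)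
    (hsep : ∀ p p', p ≠ p' → ∃ k, Disjoint (N p k) (N p' k)) : T2Space (FanSpace N) := by
  have key : ∀ p q, ∃ U V : Set (FanSpace N), IsOpen U ∧ IsOpen V ∧ center N p ∈ U ∧
      leaf N q ∈ V ∧ Disjoint U V := by
    intro p q
    obtain ⟨k, hk⟩ := hinter p q
    exact ⟨_, _, isOpen_basicNhd hN _ k, isOpen_singleton_leaf q, mem_basicNhd_self _ k, rfl,
      Set.disjoint_singleton_right.2 (mt leaf_mem_basicNhd_center.1 hk)⟩
  refine ⟨?_⟩
  rintro (p | q) (p' | q') hne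
  · obtain ⟨k, hk⟩ := hsep p p' fun h => hne (congrArg _ h)
    exact ⟨_, _, isOpen_basicNhd hN _ k, isOpen_basicNhd hN _ k, mem_basicNhd_self _ k,
      mem_basicNhd_self _ k, disjoint_basicNhd_center (fun h => hne (congrArg _ h)) hk⟩
  · exact key p q'
  · obtain ⟨U, V, hU, hV, h1, h2, h⟩ := key p' q
    exact ⟨V, U, hV, hU, h2, h1, h.symm⟩
  · exact ⟨_, _, isOpen_singleton_leaf q, isOpen_singleton_leaf q', rfl, rfl,
      Set.disjoint_singleton.2 hne⟩

theorem metrizableSpace_subtype [T2Space (FanSpace N)] (hN : ∀ p, Antitone (N p))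
    (Z : Set (FanSpace N)) (f : P → ℕ)
    (hf : ∀ p p', center N p ∈ Z → center N p' ∈ Z → p ≠ p' →
      Disjoint (N p (f p)) (N p' (f p'))) :
    TopologicalSpace.MetrizableSpace Z := by
  refine metrizableSpace_of_pairwiseDisjoint
    (fun z k => Subtype.val ⁻¹' basicNhd N z.1 k)
    (fun z => nhds_subtype_eq_comap (x := z.1) (h := z.2) ▸
      (hasAntitoneBasis_nhds hN z.1).comap _)
    {z | ∃ p, z.1 = center N p} ?_ (fun z => Sum.elim f (fun _ => 0) z.1) ?_
  · rintro ⟨p | q, hz⟩ h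
    · exact absurd ⟨p, rfl⟩ h
    · refine (isOpen_singleton_iff_nhds_eq_pure _).1 ?_
      convert (isOpen_singleton_leaf (N := N) q).preimage continuous_subtype_val using 1
      ext z
      exact Subtype.ext_iff
  · rintro ⟨z, hz⟩ ⟨p, hp⟩ ⟨z', hz'⟩ ⟨p', hp'⟩ hne
    obtain rfl : z = center N p := hp
    obtain rfl : z' = center N p' := hp'
    have hne' : p ≠ p' := fun h => hne (by subst h; rfl)
    exact (disjoint_basicNhd_center hne' (hf p p' hz hz' hne')).preimage _

theorem discreteTopology_centers (hN : ∀ p, Antitone (N p)) (Z : Set (FanSpace N)) :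
    DiscreteTopology {z : Z | ∃ p, z.1 = center N p} := by
  refine discreteTopology_iff_isOpen_singleton.2 ?_
  rintro ⟨⟨z, hz⟩, p, hp⟩
  obtain rfl : z = center N p := hp
  convert ((isOpen_basicNhd hN (center N p) 0).preimage continuous_subtype_val).preimage
    continuous_subtype_val using 1
  ext ⟨⟨z', hz'⟩, p', hp'⟩
  obtain rfl : z' = center N p' := hp'
  simp [center_mem_basicNhd_center, center_injective.eq_iff]

/-- If a fan space is collectionwise Hausdorff, all its centres can be separated at once. -/
theorem exists_disjoint_of_isCWH (hN : ∀ p, Antitone (N p))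
    (h : IsCWH (Set.univ : Set (FanSpace N))) :
    ∃ f : P → ℕ, ∀ p p', p ≠ p' → Disjoint (N p (f p)) (N p' (f p')) := by
  obtain ⟨u, hu, hmem, hdis⟩ := h _ (discreteTopology_centers hN Set.univ)
  let c : P → {z : (Set.univ : Set (FanSpace N)) | ∃ p, z.1 = center N p} :=
    fun p => ⟨⟨center N p, trivial⟩, p, rfl⟩
  have hk : ∀ p, ∃ k, ∀ q ∈ N p k, (⟨leaf N q, trivial⟩ : (Set.univ : Set (FanSpace N))) ∈
      u (c p) := by
    intro p
    obtain ⟨V, hV, hVu⟩ := isOpen_induced_iff.1 (hu (c p))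
    have hp : center N p ∈ V := by
      have := hmem (c p)
      rwa [← hVu] at this
    obtain ⟨k, hk⟩ := isOpen_iff.1 hV p hp
    refine ⟨k, fun q hq => ?_⟩
    rw [← hVu]
    exact hk k le_rfl q hq
  choose f hf using hk
  refine ⟨f, fun p p' hne => Set.disjoint_left.2 fun q hq hq' => ?_⟩
  refine Set.disjoint_left.1 (hdis (c p) (c p') fun h => hne ?_) (hf p q hq) (hf p' q hq')
  exact center_injective (congrArg (fun z => z.1.1) h)

end FanSpace

section Witness

variable {S : Type} [TopologicalSpace S]

open Classical in
/-- Adding to a small set one common point of any two intersecting basic neighbourhoods of its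
points, one can separate in the whole space what is separated in the subspaces of small size. -/
theorem exists_disjoint_of_card_lt {lam : Cardinal.{0}} (hlam : ℵ₀ < lam)
    (hsmall : ∀ T : Set S, #T < lam → IsCWN T)
    {u : S → ℕ → Set S} (hu : ∀ x, (𝓝 x).HasAntitoneBasis (u x))
    {a : Ordinal.{0}} {W : Ordinal.{0} → Set S}
    (hdis : ∀ i < a, ∀ j < a, i ≠ j → Disjoint (W i) (W j))
    (hclopen : ∀ i < a, IsClopen (Subtype.val ⁻¹' (W i) : Set (⋃ j ∈ Set.Iio a, W j)))
    (R : Set S) (hR : #R < lam) :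
    ∃ f : S → ℕ, ∀ i < a, ∀ j < a, i ≠ j → ∀ x ∈ R ∩ W i, ∀ y ∈ R ∩ W j,
      Disjoint (u x (f x)) (u y (f y)) := by
  let w : (R × ℕ) × (R × ℕ) → S := fun q =>
    if h : (u q.1.1 q.1.2 ∩ u q.2.1 q.2.2).Nonempty then h.some else q.1.1
  let T : Set S := R ∪ Set.range w
  have hRN : #(R × ℕ) < lam := by
    rw [Cardinal.mk_prod, Cardinal.lift_id, Cardinal.lift_id]
    exact Cardinal.mul_lt_of_lt hlam.le hR (by simpa using hlam)
  have hT : #T < lam := by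
    refine (Cardinal.mk_union_le _ _).trans_lt (Cardinal.add_lt_of_lt hlam.le hR ?_)
    refine Cardinal.mk_range_le.trans_lt ?_
    rw [Cardinal.mk_prod, Cardinal.lift_id]
    exact Cardinal.mul_lt_of_lt hlam.le hRN hRN
  have hmem : ∀ x : (⋃ j ∈ Set.Iio a, {x : T | x.1 ∈ R ∩ W j} : Set T),
      x.1.1 ∈ ⋃ j ∈ Set.Iio a, W j := by
    rintro ⟨x, hx⟩
    simp only [Set.mem_iUnion] at hx ⊢
    obtain ⟨j, hj, hx⟩ := hx
    exact ⟨j, hj, hx.2⟩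
  have hmemR : ∀ x : (⋃ j ∈ Set.Iio a, {x : T | x.1 ∈ R ∩ W j} : Set T), x.1.1 ∈ R := by
    rintro ⟨x, hx⟩
    simp only [Set.mem_iUnion] at hx
    obtain ⟨j, hj, hx⟩ := hx
    exact hx.1
  obtain ⟨U, hU, hsub, hUd⟩ := hsmall T hT a (fun i => {x : T | x.1 ∈ R ∩ W i})
    (fun i hi j hj hij => Set.disjoint_left.2 fun x hx hx' =>
      Set.disjoint_left.1 (hdis i hi j hj hij) hx.2 hx'.2)
    (fun i hi => by
      convert (hclopen i hi).preimage (f := fun x => ⟨x.1.1, hmem x⟩) (by fun_prop) using 1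
      ext x
      exact and_iff_right (hmemR x))
  have hk : ∀ x : S, ∃ k, ∀ i < a, x ∈ R ∩ W i → ∀ y : T, y.1 ∈ u x k → y ∈ U i := by
    intro x
    by_cases hx : ∃ i < a, x ∈ R ∩ W i
    · obtain ⟨i, hi, hxi⟩ := hx
      have hxU : (⟨x, Or.inl hxi.1⟩ : T) ∈ U i := hsub i hi hxi
      have hn := (hU i hi).mem_nhds hxU
      rw [IsInducing.subtypeVal.nhds_eq_comap, ((hu x).comap _).mem_iff] at hn
      obtain ⟨k, hk⟩ := hn
      refine ⟨k, fun j hj hxj y hy => ?_⟩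
      obtain rfl : i = j := by
        by_contra hij
        exact Set.disjoint_left.1 (hdis i hi j hj hij) hxi.2 hxj.2
      exact hk hy
    · exact ⟨0, fun i hi hxi => absurd ⟨i, hi, hxi⟩ hx⟩
  choose f hf using hk
  refine ⟨f, fun i hi j hj hij x hx y hy => ?_⟩
  by_contra hne
  have hne' : (u x (f x) ∩ u y (f y)).Nonempty := Set.not_disjoint_iff_nonempty_inter.1 hne
  let q : (R × ℕ) × (R × ℕ) := ((⟨x, hx.1⟩, f x), (⟨y, hy.1⟩, f y))
  have hw : w q ∈ u x (f x) ∩ u y (f y) := by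
    have : w q = hne'.some := dif_pos hne'
    rw [this]
    exact hne'.some_mem
  let z : T := ⟨w q, Or.inr ⟨q, rfl⟩⟩
  exact Set.disjoint_left.1 (hUd i hi j hj hij) (hf x i hi hx z hw.1) (hf y j hj hy z hw.2)

end Witness

theorem stmt17 (lam : Cardinal) (hlam : ℵ₀ < lam)
    (h : ∃ (X : Type) (t : TopologicalSpace X), @Stmt17Hyp lam X t) :
    ∃ (X : Type) (t : TopologicalSpace X), @Stmt17Concl lam X t := by
  obtain ⟨X, _, _, _, hX, hsmallX, hnot⟩ := h
  push Not at hnot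
  obtain ⟨S, hS, hnot⟩ := hnot
  have hsmall : ∀ T : Set S, #T < lam → IsCWN T := fun T hT =>
    (hsmallX _ (Cardinal.mk_image_le.trans_lt hT)).of_homeomorph
      (IsEmbedding.subtypeVal.homeomorphImage T)
  simp only [IsCWN, not_forall] at hnot
  obtain ⟨a, W, hdis, hclopen, hnot⟩ := hnot
  choose u hu using fun x : S => (𝓝 x).exists_antitone_basis
  let P := {y : S // ∃ i < a, y ∈ W i}
  choose c hca hcW using fun y : P => y.2
  let Q := {q : (P × ℕ) × (P × ℕ) // c q.1.1 ≠ c q.2.1 ∧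
    (u q.1.1.1 q.1.2 ∩ u q.2.1.1 q.2.2).Nonempty}
  let N : P → ℕ → Set Q := fun p k =>
    {q | (q.1.1.1 = p ∧ k ≤ q.1.1.2) ∨ (q.1.2.1 = p ∧ k ≤ q.1.2.2)}
  have hN : ∀ p, Antitone (N p) := fun p k l hkl q hq =>
    hq.imp (And.imp_right hkl.trans) (And.imp_right hkl.trans)
  have hNu : ∀ p p' k l, p ≠ p' → (c p ≠ c p' → Disjoint (u p.1 k) (u p'.1 l)) →
      Disjoint (N p k) (N p' l) := by
    intro p p' k l hne h
    refine Set.disjoint_left.2 ?_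
    rintro ⟨⟨⟨r, n⟩, ⟨s, m⟩⟩, hc, z, hz⟩ hq hq'
    simp only [N, Set.mem_ofPred_eq] at hq hq'
    simp only at hc hz
    rcases hq with ⟨rfl, hk⟩ | ⟨rfl, hk⟩ <;> rcases hq' with ⟨rfl, hl⟩ | ⟨rfl, hl⟩
    · exact hne rfl
    · exact Set.disjoint_left.1 (h hc) ((hu _).antitone hk hz.1) ((hu _).antitone hl hz.2)
    · exact Set.disjoint_left.1 (h hc.symm) ((hu _).antitone hk hz.2) ((hu _).antitone hl hz.1)
    · exact hne rfl
  have hT2 : T2Space (FanSpace N) := by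
    refine FanSpace.t2Space hN (fun p q => ⟨max q.1.1.2 q.1.2.2 + 1, ?_⟩) fun p p' hne => ?_
    · rintro (⟨-, h⟩ | ⟨-, h⟩)
      · exact absurd (le_max_left q.1.1.2 q.1.2.2) (by omega)
      · exact absurd (le_max_right q.1.1.2 q.1.2.2) (by omega)
    · obtain ⟨A, B, hA, hB, hpA, hpB, hAB⟩ :=
        t2_separation fun h : p.1 = p'.1 => hne (Subtype.ext h)
      obtain ⟨k, hk⟩ := (hu p.1).mem_iff.1 (hA.mem_nhds hpA)
      obtain ⟨l, hl⟩ := (hu p'.1).mem_iff.1 (hB.mem_nhds hpB)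
      exact ⟨max k l, hNu _ _ _ _ hne fun _ => hAB.mono
        (((hu _).antitone (le_max_left k l)).trans hk)
        (((hu _).antitone (le_max_right k l)).trans hl)⟩
  have hmetr : ∀ Z : Set (FanSpace N), #Z < lam → TopologicalSpace.MetrizableSpace Z := by
    intro Z hZ
    have hR : #(Subtype.val '' (FanSpace.center N ⁻¹' Z) : Set S) < lam :=
      (Cardinal.mk_image_le.trans
        (Cardinal.mk_preimage_of_injective _ _ FanSpace.center_injective)).trans_lt hZ
    obtain ⟨f, hf⟩ := exists_disjoint_of_card_lt hlam hsmall hu hdis hclopen _ hR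
    refine FanSpace.metrizableSpace_subtype hN Z (fun p => f p.1) fun p p' hp hp' hne =>
      hNu _ _ _ _ hne fun hc => ?_
    exact hf (c p) (hca p) (c p') (hca p') hc p.1 ⟨⟨p, hp, rfl⟩, hcW p⟩ p'.1
      ⟨⟨p', hp', rfl⟩, hcW p'⟩
  refine ⟨FanSpace N, inferInstance, FanSpace.firstCountableTopology hN, hT2, hmetr,
    fun Z hZ => ?_, fun hall => hnot ?_⟩
  · have := hmetr Z hZ
    exact IsCWH.of_metrizableSpace Z
  have hP : #P ≤ lam := (Cardinal.mk_subtype_le _).trans hS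
  have hPN : #(P × ℕ) ≤ lam := by
    rw [Cardinal.mk_prod, Cardinal.lift_id, Cardinal.lift_id]
    exact Cardinal.mul_le_of_le hlam.le hP (by simpa using hlam.le)
  have hQ : #Q ≤ lam := by
    refine (Cardinal.mk_subtype_le _).trans ?_
    rw [Cardinal.mk_prod, Cardinal.lift_id]
    exact Cardinal.mul_le_of_le hlam.le hPN hPN
  have hcard : #(Set.univ : Set (FanSpace N)) ≤ lam := by
    rw [Cardinal.mk_univ]
    change #(P ⊕ Q) ≤ lam
    rw [Cardinal.mk_sum, Cardinal.lift_id, Cardinal.lift_id]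
    exact Cardinal.add_le_of_le hlam.le hP hQ
  obtain ⟨f, hf⟩ := FanSpace.exists_disjoint_of_isCWH hN (hall _ hcard)
  refine ⟨fun i => ⋃ p : P, ⋃ _ : c p = i, interior (u p.1 (f p)),
    fun i _ => isOpen_iUnion fun p => isOpen_iUnion fun _ => isOpen_interior,
    fun i hi x hx => ?_, fun i _ j _ hij => ?_⟩
  · let p : P := ⟨x, i, hi, hx⟩
    have hci : c p = i := by
      by_contra hne
      exact Set.disjoint_left.1 (hdis _ (hca p) i hi hne) (hcW p) hx
    exact Set.mem_iUnion₂.2 ⟨p, hci, mem_interior_iff_mem_nhds.2 ((hu x).mem _)⟩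
  · refine Set.disjoint_left.2 fun x hx hx' => ?_
    obtain ⟨p, rfl, hp⟩ := Set.mem_iUnion₂.1 hx
    obtain ⟨p', rfl, hp'⟩ := Set.mem_iUnion₂.1 hx'
    let q : Q := ⟨((p, f p), (p', f p')), hij, x, interior_subset hp, interior_subset hp'⟩
    exact Set.disjoint_left.1 (hf p p' fun h => hij (congrArg c h))
      (show q ∈ N p (f p) from Or.inl ⟨rfl, le_rfl⟩)
      (show q ∈ N p' (f p') from Or.inr ⟨rfl, le_rfl⟩)
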